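/- For all integers n > k ≥ 0, real d ≥ 1 and B ≥ 1, the union of any d linear subvarieties of dimension k in P^n_Q contains at most c(n)·d^{n/(n+1)}·B^{k+1} rational points of height ≤ B, for some constant c depending only on n. -/

import Mathlib

/-- A point of `ℙ^n(ℚ)` has height `≤ B` if it admits homogeneous integer
coordinates all of absolute value `≤ B`. -/
def HeightLe (n : ℕ) (B : ℝ) (p : Projectivization ℚ (Fin (n + 1) → ℚ)) : Prop :=
  ∃ (v : Fin (n + 1) → ℤ) (hv : (fun i => (v i : ℚ)) ≠ 0),
    Projectivization.mk ℚ (fun i => (v i : ℚ)) hv = p ∧ ∀ i, |(v i : ℝ)| ≤ B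

/-- The integer vectors of sup norm at most `R`. -/
noncomputable def intBox (m R : ℕ) : Finset (Fin m → ℤ) :=
  Fintype.piFinset fun _ => Finset.Icc (-(R : ℤ)) R

/-- The sup norm of an integer vector, as a natural number. -/
def supNatAbs {m : ℕ} (x : Fin m → ℤ) : ℕ := Finset.univ.sup fun i => (x i).natAbs

/-- The inclusion `ℤ^m → ℚ^m`. -/
def ratVec (m : ℕ) : (Fin m → ℤ) →+ (Fin m → ℚ) := (Int.castAddHom ℚ).compLeft (Fin m)

open Classical in
/-- The integer points of sup norm at most `R` in a rational subspace. -/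
noncomputable def boxPoints {m : ℕ} (W : Submodule ℚ (Fin m → ℚ)) (R : ℕ) :
    Finset (Fin m → ℤ) :=
  {x ∈ intBox m R | ratVec m x ∈ W}

/-- `ReducedFlag r W D L` says that `W` is the span of integer vectors `v₁, …, vᵣ` which realise its
successive minima, where `D` is the product of their sup norms and `L` the sup norm of `vᵣ`. -/
inductive ReducedFlag {m : ℕ} : ℕ → Submodule ℚ (Fin m → ℚ) → ℕ → ℕ → Prop
  | bot : ReducedFlag 0 ⊥ 1 1
  | sup_span {r : ℕ} {W : Submodule ℚ (Fin m → ℚ)} {D L : ℕ} (v : Fin m → ℤ) :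
      ReducedFlag r W D L → ratVec m v ∉ W → L ≤ supNatAbs v →
      (∀ x, ratVec m x ∈ W ⊔ ℚ ∙ ratVec m v → supNatAbs x < supNatAbs v → ratVec m x ∈ W) →
      ReducedFlag (r + 1) (W ⊔ ℚ ∙ ratVec m v) (D * supNatAbs v) (supNatAbs v)

section boxes

variable {m : ℕ}

@[simp]
lemma ratVec_apply (x : Fin m → ℤ) (i : Fin m) : ratVec m x i = x i := rfl

lemma ratVec_injective : Function.Injective (ratVec m) := fun x y h => by
  ext i
  simpa using congrFun h i

lemma supNatAbs_le {x : Fin m → ℤ} {R : ℕ} : supNatAbs x ≤ R ↔ ∀ i, |x i| ≤ R := by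
  simp only [supNatAbs, Finset.sup_le_iff, Finset.mem_univ, true_imp_iff, Int.abs_eq_natAbs]
  norm_cast

lemma mem_intBox {x : Fin m → ℤ} {R : ℕ} : x ∈ intBox m R ↔ supNatAbs x ≤ R := by
  simp [intBox, supNatAbs_le, abs_le]

lemma card_intBox (m R : ℕ) : (intBox m R).card = (2 * R + 1) ^ m := by
  have : ((R : ℤ) + 1 + R).toNat = 2 * R + 1 := by omega
  simp [intBox, this]

lemma mem_boxPoints {W : Submodule ℚ (Fin m → ℚ)} {R : ℕ} {x : Fin m → ℤ} :
    x ∈ boxPoints W R ↔ supNatAbs x ≤ R ∧ ratVec m x ∈ W := by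
  simp [boxPoints, mem_intBox]

lemma supNatAbs_add_le (x y : Fin m → ℤ) : supNatAbs (x + y) ≤ supNatAbs x + supNatAbs y := by
  rw [supNatAbs_le]
  intro i
  have hx := supNatAbs_le.1 (le_refl (supNatAbs x)) i
  have hy := supNatAbs_le.1 (le_refl (supNatAbs y)) i
  push_cast
  exact (abs_add_le _ _).trans (add_le_add hx hy)

lemma supNatAbs_nsmul_le (a : ℕ) (x : Fin m → ℤ) : supNatAbs (a • x) ≤ a * supNatAbs x := by
  rw [supNatAbs_le]
  intro i
  have hx := supNatAbs_le.1 (le_refl (supNatAbs x)) i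
  simp only [Pi.smul_apply, nsmul_eq_mul, abs_mul, Nat.abs_cast]
  push_cast
  gcongr

lemma supNatAbs_pos {W : Submodule ℚ (Fin m → ℚ)} {x : Fin m → ℤ} (hx : ratVec m x ∉ W) :
    0 < supNatAbs x := by
  by_contra! h
  have : x = 0 := by
    ext i
    simpa using supNatAbs_le.1 h i
  exact hx (by simp [this])

/-- A subspace of dimension at most `q` is controlled by at most `q` of its coordinates. -/
lemma exists_controlling_coords (q : ℕ) (W : Submodule ℚ (Fin m → ℚ))
    (hW : Module.finrank ℚ W ≤ q) :
    ∃ I : Finset (Fin m), I.card ≤ q ∧ ∀ x ∈ W, ∀ t : ℚ, 0 ≤ t → (∀ i ∈ I, |x i| ≤ t) →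
      ∀ i, |x i| ≤ 3 ^ q * t := by
  induction q generalizing W with
  | zero =>
    have : W = ⊥ := Submodule.finrank_eq_zero.1 (by omega)
    subst this
    refine ⟨∅, by simp, fun x hx t ht _ i => ?_⟩
    rw [(Submodule.mem_bot ℚ).1 hx]
    simpa using ht
  | succ q ih =>
    by_cases hbot : W = ⊥
    · subst hbot
      refine ⟨∅, by simp, fun x hx t ht _ i => ?_⟩
      rw [(Submodule.mem_bot ℚ).1 hx]
      simp only [Pi.zero_apply, abs_zero]
      positivity
    obtain ⟨w, hw, hw0⟩ := Submodule.exists_mem_ne_zero_of_ne_bot hbot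
    obtain ⟨j, hj⟩ := Function.ne_iff.1 hw0
    obtain ⟨i₀, -, hi₀⟩ := Finset.exists_max_image Finset.univ (fun i => |w i|) ⟨j, by simp⟩
    have hpos : 0 < |w i₀| := (abs_pos.2 hj).trans_le (hi₀ j (by simp))
    let W' : Submodule ℚ (Fin m → ℚ) := W ⊓ LinearMap.ker (LinearMap.proj (R := ℚ) i₀)
    have hlt : W' < W := by
      refine lt_of_le_of_ne inf_le_left fun h => ?_
      have : w ∈ W' := h ▸ hw
      have h0 : w i₀ = 0 := this.2
      simp [h0] at hpos
    obtain ⟨I, hI, hIW⟩ := ih W' (by have := Submodule.finrank_lt_finrank_of_lt hlt; omega)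
    refine ⟨insert i₀ I, (Finset.card_insert_le _ _).trans (by omega), fun x hx t ht hxt i => ?_⟩
    have hw' : w i₀ ≠ 0 := abs_pos.1 hpos
    set s := x i₀ / w i₀ with hs
    have hsw : ∀ i, |s * w i| ≤ t := fun i => by
      have h1 : |s| * |w i₀| ≤ t := by
        rw [← abs_mul, hs, div_mul_cancel₀ _ hw']
        exact hxt i₀ (by simp)
      rw [abs_mul]
      exact (mul_le_mul_of_nonneg_left (hi₀ i (by simp)) (abs_nonneg s)).trans h1
    have hx' : x - s • w ∈ W' := by
      refine ⟨W.sub_mem hx (W.smul_mem _ hw), ?_⟩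
      simp [hs, hw']
    have key := hIW _ hx' (2 * t) (by positivity) (fun j hj => by
      have h1 := abs_sub (x j) (s * w j)
      have h2 := hxt j (by simp [hj])
      have h3 := hsw j
      simp only [Pi.sub_apply, Pi.smul_apply, smul_eq_mul]
      linarith) i
    have h1 := abs_add_le (x i - s * w i) (s * w i)
    have h3 := hsw i
    have h4 : (1 : ℚ) ≤ 3 ^ q := one_le_pow₀ (by norm_num)
    simp only [Pi.sub_apply, Pi.smul_apply, smul_eq_mul] at key
    rw [sub_add_cancel] at h1
    rw [pow_succ]
    nlinarith

/-- Passing from norm `< l` to norm `≤ R` multiplies the number of integer points in a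
`q`-dimensional subspace by at most a constant times `(R / l) ^ q`. -/
lemma pow_mul_card_boxPoints_le (q : ℕ) (W : Submodule ℚ (Fin m → ℚ))
    (hW : Module.finrank ℚ W ≤ q) {l R : ℕ} (hl : 0 < l) (hR : l ≤ R) :
    l ^ q * (boxPoints W R).card ≤
      ((2 * 3 ^ q + 3) * R) ^ q * (boxPoints W (l - 1)).card := by
  obtain ⟨I, hI, hIW⟩ := exists_controlling_coords q W hW
  set Q : ℕ := 3 ^ q * R / l + 1 with hQ
  let cell : (Fin m → ℤ) → (I → ℤ) := fun x i => 3 ^ q * x i / (l : ℤ)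
  let T : Finset (I → ℤ) := Fintype.piFinset fun _ => Finset.Icc (-(Q : ℤ)) Q
  have hl' : (0 : ℤ) < l := by exact_mod_cast hl
  have hcell : ∀ x ∈ boxPoints W R, cell x ∈ T := by
    intro x hx
    rw [mem_boxPoints] at hx
    refine Fintype.mem_piFinset.2 fun i => ?_
    have h1 := abs_le.1 (supNatAbs_le.1 hx.1 i)
    have hdiv : ((3 : ℤ) ^ q * R) < l * Q := by
      have := Nat.lt_mul_div_succ (3 ^ q * R) hl
      exact_mod_cast this
    have h3 : (0 : ℤ) < 3 ^ q := by positivity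
    rw [Finset.mem_Icc]
    constructor
    · rw [Int.le_ediv_iff_mul_le hl']
      nlinarith
    · refine Int.le_of_lt_add_one ?_
      rw [Int.ediv_lt_iff_lt_mul hl']
      nlinarith
  have hfib : ∀ e ∈ T, ((boxPoints W R).filter fun x => cell x = e).card ≤
      (boxPoints W (l - 1)).card := by
    intro e _
    rcases ((boxPoints W R).filter fun x => cell x = e).eq_empty_or_nonempty with h | ⟨y, hy⟩
    · simp [h]
    refine Finset.card_le_card_of_injOn (fun x => x - y) (fun x hx => ?_)
      (fun x _ z _ h => by simpa using h)
    simp only [Finset.coe_filter, Finset.mem_filter, mem_boxPoints, Set.mem_ofPred_eq] at hx hy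
    have hmem : ratVec m (x - y) ∈ W := by
      rw [map_sub]
      exact W.sub_mem hx.1.2 hy.1.2
    refine Finset.mem_coe.2 (mem_boxPoints.2 ⟨supNatAbs_le.2 fun i => ?_, hmem⟩)
    have hlq : (((l - 1 : ℕ) : ℤ) : ℚ) = (l : ℚ) - 1 := by
      push_cast [Nat.cast_sub (Nat.one_le_of_lt hl)]
      ring
    have := hIW _ hmem (((l - 1 : ℕ) : ℚ) / 3 ^ q) (by positivity) (fun i hi => by
      have h1 : 3 ^ q * x i / (l : ℤ) = 3 ^ q * y i / (l : ℤ) :=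
        (congrFun hx.2 ⟨i, hi⟩).trans (congrFun hy.2 ⟨i, hi⟩).symm
      have h2 := Int.emod_add_mul_ediv (3 ^ q * x i) l
      have h3 := Int.emod_add_mul_ediv (3 ^ q * y i) l
      have h4 := Int.emod_nonneg (3 ^ q * x i) hl'.ne'
      have h5 := Int.emod_nonneg (3 ^ q * y i) hl'.ne'
      have h6 := Int.emod_lt_of_pos (3 ^ q * x i) hl'
      have h7 := Int.emod_lt_of_pos (3 ^ q * y i) hl'
      rw [h1] at h2
      have h8 : |3 ^ q * x i - 3 ^ q * y i| ≤ ((l - 1 : ℕ) : ℤ) := by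
        rw [abs_le]
        constructor <;> omega
      rw [← mul_sub, abs_mul, abs_of_pos (by positivity : (0 : ℤ) < 3 ^ q)] at h8
      rw [le_div_iff₀ (by positivity), mul_comm]
      simp only [ratVec_apply, Pi.sub_apply]
      exact_mod_cast h8) i
    rw [mul_div_cancel₀ _ (by positivity)] at this
    simp only [ratVec_apply] at this
    exact_mod_cast this
  have hcard : (boxPoints W R).card ≤ (2 * Q + 1) ^ q * (boxPoints W (l - 1)).card := by
    have h1 := Finset.card_le_mul_card_image_of_maps_to hcell _ hfib
    have h2 : T.card ≤ (2 * Q + 1) ^ q := by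
      have : ((Q : ℤ) + 1 + Q).toNat = 2 * Q + 1 := by omega
      simp only [T, Fintype.card_piFinset, Int.card_Icc, sub_neg_eq_add, this,
        Finset.prod_const, Finset.card_univ, Fintype.card_coe]
      exact Nat.pow_le_pow_right (by omega) hI
    rw [mul_comm] at h1
    exact h1.trans (Nat.mul_le_mul_right _ h2)
  calc l ^ q * (boxPoints W R).card
      ≤ l ^ q * ((2 * Q + 1) ^ q * (boxPoints W (l - 1)).card) := Nat.mul_le_mul_left _ hcard
    _ = (l * (2 * Q + 1)) ^ q * (boxPoints W (l - 1)).card := by rw [mul_pow, mul_assoc]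
    _ ≤ _ := by
      refine Nat.mul_le_mul_right _ (Nat.pow_le_pow_left ?_ _)
      have := Nat.mul_div_le (3 ^ q * R) l
      rw [hQ]
      nlinarith

end boxes

namespace ReducedFlag

variable {m r D L : ℕ} {W : Submodule ℚ (Fin m → ℚ)}

lemma finrank_eq (h : ReducedFlag r W D L) : Module.finrank ℚ W = r := by
  induction h with
  | bot => simp
  | sup_span v _ hv _ _ ih =>
    rw [Submodule.finrank_sup_span_singleton hv, ih]

lemma one_le_last (h : ReducedFlag r W D L) : 1 ≤ L := by
  induction h with
  | bot => simp
  | sup_span v _ hv _ _ ih => exact supNatAbs_pos hv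

lemma one_le_prod (h : ReducedFlag r W D L) : 1 ≤ D := by
  induction h with
  | bot => simp
  | sup_span v _ hv _ _ ih => exact Nat.mul_pos ih (supNatAbs_pos hv)

lemma prod_le_pow (h : ReducedFlag r W D L) : D ≤ L ^ r := by
  induction h with
  | bot => simp
  | sup_span v _ hv hL _ ih =>
    rw [pow_succ]
    exact Nat.mul_le_mul_right _ (ih.trans (Nat.pow_le_pow_left hL _))

lemma exists_prod_mul_card_le (m r : ℕ) : ∃ A : ℕ, ∀ (W : Submodule ℚ (Fin m → ℚ)) (D L : ℕ),
    ReducedFlag r W D L → ∀ R, L ≤ R → D * (boxPoints W R).card ≤ A * R ^ r := by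
  induction r with
  | zero =>
    refine ⟨1, fun W D L h R _ => ?_⟩
    cases h
    simp only [one_mul, pow_zero]
    refine Finset.card_le_one.2 fun x hx y hy => ratVec_injective ?_
    rw [(Submodule.mem_bot ℚ).1 (mem_boxPoints.1 hx).2,
      (Submodule.mem_bot ℚ).1 (mem_boxPoints.1 hy).2]
  | succ r ih =>
    obtain ⟨A, hA⟩ := ih
    refine ⟨(2 * 3 ^ (r + 1) + 3) ^ (r + 1) * A, fun W' D' L' h R hR => ?_⟩
    have hrank := h.finrank_eq
    cases h with
    | @sup_span _ W D L v hW hv hL hmin =>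
    have hl := supNatAbs_pos hv
    have h1 := pow_mul_card_boxPoints_le (r + 1) _ hrank.le hl hR
    have h2 : (boxPoints (W ⊔ ℚ ∙ ratVec m v) (supNatAbs v - 1)).card ≤
        (boxPoints W (supNatAbs v)).card := by
      refine Finset.card_le_card fun x hx => ?_
      rw [mem_boxPoints] at hx ⊢
      exact ⟨by omega, hmin x hx.2 (by omega)⟩
    have h3 := hA W D L hW _ hL
    set l := supNatAbs v
    set N := (boxPoints (W ⊔ ℚ ∙ ratVec m v) R).card
    set C := 2 * 3 ^ (r + 1) + 3
    refine Nat.le_of_mul_le_mul_left ?_ (pow_pos hl r)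
    calc l ^ r * (D * l * N) = D * (l ^ (r + 1) * N) := by ring
      _ ≤ D * ((C * R) ^ (r + 1) * (boxPoints W l).card) :=
        Nat.mul_le_mul_left _ (h1.trans (Nat.mul_le_mul_left _ h2))
      _ = (C * R) ^ (r + 1) * (D * (boxPoints W l).card) := by ring
      _ ≤ (C * R) ^ (r + 1) * (A * l ^ r) := Nat.mul_le_mul_left _ h3
      _ = l ^ r * (C ^ (r + 1) * A * R ^ (r + 1)) := by rw [mul_pow]; ring

lemma pow_le_prod_mul_card (h : ReducedFlag r W D L) (R : ℕ) :
    R ^ r ≤ D * (boxPoints W (r * R)).card := by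
  induction h with
  | bot =>
    rw [pow_zero, one_mul, Nat.one_le_iff_ne_zero, Finset.card_ne_zero]
    exact ⟨0, mem_boxPoints.2 ⟨supNatAbs_le.2 (by simp), by simp⟩⟩
  | @sup_span r W D L v hW hv hL hmin ih =>
    have hl := supNatAbs_pos hv
    set l := supNatAbs v
    have h1 : (boxPoints W (r * R)).card * (R / l + 1) ≤
        (boxPoints (W ⊔ ℚ ∙ ratVec m v) ((r + 1) * R)).card := by
      rw [← Finset.card_range (R / l + 1), ← Finset.card_product]
      refine Finset.card_le_card_of_injOn (fun p => p.1 + p.2 • v) ?_ ?_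
      · rintro ⟨x, a⟩ hp
        simp only [Finset.coe_product, Set.mem_prod, Finset.mem_coe, mem_boxPoints,
          Finset.mem_range] at hp ⊢
        refine ⟨(supNatAbs_add_le _ _).trans ?_, ?_⟩
        · have h2 : supNatAbs (a • v) ≤ a * l := supNatAbs_nsmul_le a v
          have h3 : a * l ≤ R := (Nat.le_div_iff_mul_le hl).1 (by omega)
          have := hp.1.1
          rw [add_mul, one_mul]
          omega
        · rw [map_add, map_nsmul]
          refine Submodule.add_mem_sup hp.1.2 ?_
          exact Submodule.smul_of_tower_mem _ a (Submodule.mem_span_singleton_self _)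
      · rintro ⟨x, a⟩ hp ⟨y, b⟩ hq hxy
        simp only [Finset.coe_product, Set.mem_prod, Finset.mem_coe, mem_boxPoints] at hp hq
        have h2 : ((b : ℚ) - a) • ratVec m v = ratVec m x - ratVec m y := by
          have := congrArg (ratVec m) hxy
          simp only [map_add, map_nsmul, ← Nat.cast_smul_eq_nsmul ℚ] at this
          rw [sub_smul, sub_eq_sub_iff_add_eq_add, add_comm, ← this, add_comm]
        have hab : a = b := by
          by_contra hne
          have : (b : ℚ) - a ≠ 0 := sub_ne_zero.2 (by exact_mod_cast Ne.symm hne)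
          exact hv ((Submodule.smul_mem_iff W this).1 (h2 ▸ W.sub_mem hp.1.2 hq.1.2))
        subst hab
        simpa using hxy
    have h2 : R ≤ l * (R / l + 1) := (Nat.lt_mul_div_succ R hl).le
    calc R ^ (r + 1) = R ^ r * R := pow_succ _ _
      _ ≤ (D * (boxPoints W (r * R)).card) * (l * (R / l + 1)) := Nat.mul_le_mul ih h2
      _ = D * l * ((boxPoints W (r * R)).card * (R / l + 1)) := by ring
      _ ≤ _ := Nat.mul_le_mul_left _ h1

end ReducedFlag

namespace ReducedFlag

/-- The integer points of norm at most `B` in `V` are those of a subspace of `V` spanned by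
successive minima of size at most `B`. -/
lemma exists_boxPoints_subset {m : ℕ} (V : Submodule ℚ (Fin m → ℚ)) {B : ℕ} (hB : 1 ≤ B) :
    ∃ r W D L, ReducedFlag r W D L ∧ L ≤ B ∧ W ≤ V ∧ boxPoints V B ⊆ boxPoints W B := by
  by_contra! hcon
  have key : ∀ r, ∃ W D L, ReducedFlag r W D L ∧ L ≤ B ∧ W ≤ V ∧
      ∀ x, ratVec m x ∈ V → ratVec m x ∉ W → L ≤ supNatAbs x := by
    intro r
    induction r with
    | zero => exact ⟨⊥, 1, 1, .bot, hB, bot_le, fun x _ hx => supNatAbs_pos hx⟩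
    | succ r ih =>
      obtain ⟨W, D, L, hW, hL, hWV, hmin⟩ := ih
      obtain ⟨y, hyV, hyW⟩ := Finset.not_subset.1 (hcon r W D L hW hL hWV)
      rw [mem_boxPoints] at hyV hyW
      obtain ⟨v, ⟨hvV, hvW⟩, hv⟩ := exists_minimalFor_of_wellFoundedLT
        (fun x => ratVec m x ∈ V ∧ ratVec m x ∉ W) supNatAbs
        ⟨y, hyV.2, fun h => hyW ⟨hyV.1, h⟩⟩
      have hv' : ∀ x, ratVec m x ∈ V → ratVec m x ∉ W → supNatAbs v ≤ supNatAbs x := by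
        intro x hxV hxW
        by_contra! hlt
        exact absurd (hv ⟨hxV, hxW⟩ hlt.le) (by omega)
      have hle : W ⊔ ℚ ∙ ratVec m v ≤ V :=
        sup_le hWV ((Submodule.span_singleton_le_iff_mem _ _).2 hvV)
      refine ⟨_, _, _, .sup_span v hW hvW (hmin v hvV hvW) fun x hx hxv => ?_,
        (hv' y hyV.2 fun h => hyW ⟨hyV.1, h⟩).trans hyV.1, hle,
        fun x hxV hxW => hv' x hxV fun h => hxW (Submodule.mem_sup_left h)⟩
      by_contra hxW
      exact absurd (hv' x (hle hx) hxW) (by omega)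
  obtain ⟨W, D, L, hW, -, hWV, -⟩ := key (Module.finrank ℚ V + 1)
  have := Submodule.finrank_mono hWV
  rw [hW.finrank_eq] at this
  omega

end ReducedFlag

lemma card_mul_card_boxPoints_le {m : ℕ} (W : Submodule ℚ (Fin m → ℚ)) (S T : ℕ)
    (𝒱 : Finset (Submodule ℚ (Fin m → ℚ)))
    (v : Submodule ℚ (Fin m → ℚ) → Fin m → ℤ)
    (h𝒱 : ∀ V ∈ 𝒱, V = W ⊔ ℚ ∙ ratVec m (v V)) (hv : ∀ V ∈ 𝒱, supNatAbs (v V) ≤ T) :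
    𝒱.card * (boxPoints W S).card ≤ (2 * (T + S) + 1) ^ m := by
  rw [← card_intBox, ← Finset.card_product]
  have hspan : ∀ u x : Fin m → ℚ, x ∈ W → W ⊔ ℚ ∙ (u + x) ≤ W ⊔ ℚ ∙ u := by
    intro u x hx
    refine sup_le le_sup_left ((Submodule.span_singleton_le_iff_mem _ _).2 ?_)
    exact Submodule.add_mem _ (Submodule.mem_sup_right (Submodule.mem_span_singleton_self u))
      (Submodule.mem_sup_left hx)
  have hspan' : ∀ u x : Fin m → ℚ, x ∈ W → W ⊔ ℚ ∙ (u + x) = W ⊔ ℚ ∙ u := by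
    intro u x hx
    refine le_antisymm (hspan u x hx) ?_
    simpa using hspan (u + x) (-x) (W.neg_mem hx)
  refine Finset.card_le_card_of_injOn (fun p => v p.1 + p.2) ?_ ?_
  · rintro ⟨V, x⟩ hp
    simp only [Finset.coe_product, Set.mem_prod, Finset.mem_coe, mem_boxPoints, mem_intBox] at hp ⊢
    exact (supNatAbs_add_le _ _).trans (add_le_add (hv V hp.1) hp.2.1)
  · rintro ⟨V, x⟩ hp ⟨V', y⟩ hq hxy
    simp only [Finset.coe_product, Set.mem_prod, Finset.mem_coe, mem_boxPoints] at hp hq hxy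
    have hV : V = V' := by
      rw [h𝒱 V hp.1, h𝒱 V' hq.1, ← hspan' (ratVec m (v V)) _ hp.2.2,
        ← hspan' (ratVec m (v V')) _ hq.2.2, ← map_add, ← map_add, hxy]
    subst hV
    simpa using hxy

namespace ReducedFlag

/-- The number of subspaces whose successive minima have product at most `2 ^ h` is
`O(2 ^ (h * m))`. -/
lemma exists_card_le {m : ℕ} (hm : 0 < m) (r : ℕ) : ∃ C : ℕ, ∀ (h : ℕ)
    (𝒱 : Finset (Submodule ℚ (Fin m → ℚ))),
    (∀ V ∈ 𝒱, ∃ D L, ReducedFlag r V D L ∧ D ≤ 2 ^ h) → 𝒱.card ≤ C * 2 ^ (h * m) := by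
  classical
  induction r with
  | zero =>
    refine ⟨1, fun h 𝒱 h𝒱 => ?_⟩
    have : 𝒱.card ≤ 1 := Finset.card_le_one.2 fun V hV V' hV' => by
      obtain ⟨D, L, hD, -⟩ := h𝒱 V hV
      obtain ⟨D', L', hD', -⟩ := h𝒱 V' hV'
      cases hD
      cases hD'
      rfl
    have := Nat.one_le_two_pow (n := h * m)
    omega
  | succ r ih =>
    obtain ⟨C, hC⟩ := ih
    set K := C * (2 * r + 5) ^ m * 2 ^ (m + 1) with hK
    refine ⟨K * 2 ^ (r + 1) * 2, fun h 𝒱 h𝒱 => ?_⟩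
    have h𝒱' : ∀ V ∈ 𝒱, ∃ W D L v, ReducedFlag r W D L ∧ ratVec m v ∉ W ∧
        V = W ⊔ ℚ ∙ ratVec m v ∧ L ≤ supNatAbs v ∧ D * supNatAbs v ≤ 2 ^ h := by
      intro V hV
      obtain ⟨D', L', hD', hle⟩ := h𝒱 V hV
      cases hD' with
      | sup_span v hW hv hL _ => exact ⟨_, _, _, v, hW, hv, rfl, hL, hle⟩
    choose! W D L v hW hvW hV hL hDv using h𝒱'
    let a := fun V => Nat.log 2 (supNatAbs (v V))
    let b := fun V => Nat.log 2 (D V)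
    have ha : ∀ V ∈ 𝒱, 2 ^ a V ≤ supNatAbs (v V) := fun V h =>
      Nat.pow_log_le_self 2 (supNatAbs_pos (hvW V h)).ne'
    have ha' : ∀ V, supNatAbs (v V) < 2 ^ (a V + 1) := fun V =>
      Nat.lt_pow_succ_log_self (by norm_num) _
    have hb : ∀ V ∈ 𝒱, 2 ^ b V ≤ D V := fun V h =>
      Nat.pow_log_le_self 2 (Nat.ne_of_gt (hW V h).one_le_prod)
    have hb' : ∀ V, D V < 2 ^ (b V + 1) := fun V =>
      Nat.lt_pow_succ_log_self (by norm_num) _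
    have hab : ∀ V ∈ 𝒱, a V + b V ≤ h := fun V h => by
      refine (Nat.pow_le_pow_iff_right (a := 2) (by norm_num)).1 (le_trans ?_ (hDv V h))
      rw [add_comm, pow_add]
      exact Nat.mul_le_mul (hb V h) (ha V h)
    have hbr : ∀ V ∈ 𝒱, b V * (r + 1) ≤ (a V + b V + 1) * r := fun V h => by
      have : b V ≤ (a V + 1) * r := by
        refine (Nat.pow_le_pow_iff_right (a := 2) (by norm_num)).1 ?_
        rw [pow_mul]
        exact (hb V h).trans ((hW V h).prod_le_pow.trans
          (Nat.pow_le_pow_left ((hL V h).trans (ha' V).le) _))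
      nlinarith
    -- subspaces with `supNatAbs v ∼ 2 ^ i` and `D ∼ 2 ^ j`
    have hfib : ∀ i j, (𝒱.filter fun V => a V = i ∧ b V = j).card * 2 ^ (i * r) ≤
        K * 2 ^ (j * (m + 1) + i * m) := by
      intro i j
      set 𝒰 := 𝒱.filter fun V => a V = i ∧ b V = j with h𝒰
      have hmem : ∀ V ∈ 𝒰, V ∈ 𝒱 ∧ a V = i ∧ b V = j := fun V h => by simpa [h𝒰] using h
      have himage : (𝒰.image W).card ≤ C * 2 ^ ((j + 1) * m) := by
        refine hC _ _ fun U hU => ?_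
        obtain ⟨V, hVU, rfl⟩ := Finset.mem_image.1 hU
        obtain ⟨h1, -, h3⟩ := hmem V hVU
        exact ⟨_, _, hW V h1, h3 ▸ (hb' V).le⟩
      have hone : ∀ U ∈ 𝒰.image W, (𝒰.filter fun V => W V = U).card * 2 ^ (i * r) ≤
          2 ^ (j + 1) * ((2 * r + 5) ^ m * 2 ^ (i * m)) := by
        intro U hU
        obtain ⟨V₀, hV₀, rfl⟩ := Finset.mem_image.1 hU
        obtain ⟨h1, h2, h3⟩ := hmem V₀ hV₀
        have hlow := (hW V₀ h1).pow_le_prod_mul_card (2 ^ i)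
        have hup := card_mul_card_boxPoints_le (W V₀) (r * 2 ^ i) (2 ^ (i + 1))
          (𝒰.filter fun V => W V = W V₀) v
          (fun V h => by
            obtain ⟨h4, h5⟩ := Finset.mem_filter.1 h
            rw [← h5]
            exact hV V (hmem V h4).1)
          (fun V h => by
            obtain ⟨h4, -⟩ := Finset.mem_filter.1 h
            have := ha' V
            rw [(hmem V h4).2.1] at this
            exact this.le)
        have hD : D V₀ ≤ 2 ^ (j + 1) := h3 ▸ (hb' V₀).le
        have hpow : (2 * (2 ^ (i + 1) + r * 2 ^ i) + 1) ^ m ≤ (2 * r + 5) ^ m * 2 ^ (i * m) := by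
          rw [pow_mul 2 i m, ← mul_pow]
          refine Nat.pow_le_pow_left ?_ _
          have := Nat.one_le_two_pow (n := i)
          rw [pow_succ]
          nlinarith
        set F := (𝒰.filter fun V => W V = W V₀).card
        calc F * 2 ^ (i * r) ≤ F * (D V₀ * (boxPoints (W V₀) (r * 2 ^ i)).card) := by
              rw [pow_mul]
              exact Nat.mul_le_mul_left _ hlow
          _ = D V₀ * (F * (boxPoints (W V₀) (r * 2 ^ i)).card) := by ring
          _ ≤ _ := Nat.mul_le_mul hD (hup.trans hpow)
      rw [Finset.card_eq_sum_card_image W 𝒰, Finset.sum_mul]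
      refine (Finset.sum_le_card_nsmul _ _ _ hone).trans ?_
      rw [smul_eq_mul]
      refine (Nat.mul_le_mul_right _ himage).trans (le_of_eq ?_)
      rw [hK]
      ring
    have hdiag : ∀ s, (𝒱.filter fun V => a V + b V = s).card ≤ K * 2 ^ (r + 1) * 2 ^ (s * m) := by
      intro s
      set 𝒰 := 𝒱.filter fun V => a V + b V = s with h𝒰
      have hmem : ∀ V ∈ 𝒰, V ∈ 𝒱 ∧ a V + b V = s := fun V h => by simpa [h𝒰] using h
      have hone : ∀ j ∈ 𝒰.image b, (𝒰.filter fun V => b V = j).card * 2 ^ (s * r) ≤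
          K * 2 ^ (s * m) * 2 ^ (j * (r + 1)) := by
        intro j hj
        obtain ⟨V₀, hV₀, rfl⟩ := Finset.mem_image.1 hj
        obtain ⟨-, h2⟩ := hmem V₀ hV₀
        have h3 := hfib (a V₀) (b V₀)
        have h4 : 𝒰.filter (fun V => b V = b V₀) ⊆
            𝒱.filter fun V => a V = a V₀ ∧ b V = b V₀ := by
          intro V h
          obtain ⟨h5, h6⟩ := Finset.mem_filter.1 h
          obtain ⟨h7, h8⟩ := hmem V h5
          exact Finset.mem_filter.2 ⟨h7, by omega, h6⟩
        have h5 := (Nat.mul_le_mul_right _ (Finset.card_le_card h4)).trans h3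
        rw [← h2]
        calc _ = (𝒰.filter fun V => b V = b V₀).card * 2 ^ (a V₀ * r) * 2 ^ (b V₀ * r) := by ring
          _ ≤ _ := Nat.mul_le_mul_right _ h5
          _ = _ := by ring
      have hsum : ∑ j ∈ 𝒰.image b, 2 ^ (j * (r + 1)) ≤ 2 ^ ((s + 1) * r + 1) := by
        rw [← Finset.sum_image (s := 𝒰.image b) (g := fun j => j * (r + 1)) (f := fun e => 2 ^ e)
          (fun x _ y _ hxy => Nat.eq_of_mul_eq_mul_right r.succ_pos hxy)]
        refine (Nat.geomSum_lt le_rfl fun e he => ?_).le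
        simp only [Finset.mem_image, exists_exists_and_eq_and] at he
        obtain ⟨V, hVU, rfl⟩ := he
        obtain ⟨h1, rfl⟩ := hmem V hVU
        have := hbr V h1
        omega
      refine Nat.le_of_mul_le_mul_right ?_ (Nat.two_pow_pos (s * r))
      rw [Finset.card_eq_sum_card_image b 𝒰, Finset.sum_mul]
      refine (Finset.sum_le_sum hone).trans ?_
      rw [← Finset.mul_sum]
      refine (Nat.mul_le_mul_left _ hsum).trans (le_of_eq ?_)
      ring
    rw [Finset.card_eq_sum_card_fiberwise (f := fun V => a V + b V) (t := Finset.range (h + 1))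
      (fun V hV => by simpa [Nat.lt_succ_iff] using hab V hV)]
    refine (Finset.sum_le_sum fun s _ => hdiag s).trans ?_
    rw [← Finset.mul_sum, mul_assoc (K * 2 ^ (r + 1)), ← pow_succ']
    refine Nat.mul_le_mul_left _ ?_
    rw [← Finset.sum_image (g := fun s => s * m) (f := fun e => 2 ^ e)
      (fun x _ y _ hxy => Nat.eq_of_mul_eq_mul_right hm hxy)]
    refine (Nat.geomSum_lt le_rfl fun e he => ?_).le
    obtain ⟨s, hs, rfl⟩ := Finset.mem_image.1 he
    exact Nat.lt_succ_of_le (Nat.mul_le_mul_right _ (Finset.mem_range_succ_iff.1 hs))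

end ReducedFlag

lemma sum_two_pow_mul_le {n : ℕ} (hn : 1 ≤ n) (h : ℕ) :
    ∑ j ∈ Finset.range h, (2 : ℝ) ^ (j * n) ≤ 2 ^ (h * n) := by
  induction h with
  | zero => simp
  | succ h ih =>
    rw [Finset.sum_range_succ, add_mul, one_mul, pow_add]
    have h1 : (2 : ℝ) ^ 1 ≤ 2 ^ n := pow_le_pow_right₀ (by norm_num) hn
    have h2 : (0 : ℝ) < 2 ^ (h * n) := by positivity
    nlinarith

/-- If at most `C * 2 ^ (h * (n + 1))` of the `D a` are `≤ 2 ^ h`, for all `h`, then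
the sum of the inverses of `t ^ (n + 1)` of them is `O(t ^ n)`. -/
lemma sum_inv_le {α : Type*} (s : Finset α) (D : α → ℕ) (C : ℝ) {n : ℕ} (hC : 0 ≤ C)
    (hn : 1 ≤ n) (hD : ∀ a ∈ s, 1 ≤ D a)
    (hcard : ∀ h : ℕ, ((s.filter fun a => D a ≤ 2 ^ h).card : ℝ) ≤ C * 2 ^ (h * (n + 1)))
    {t : ℝ} (ht : 1 ≤ t) (hs : (s.card : ℝ) ≤ t ^ (n + 1)) :
    ∑ a ∈ s, (D a : ℝ)⁻¹ ≤ (2 + C * 2 ^ (n + 1)) * t ^ n := by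
  obtain ⟨h, hht, hth⟩ := exists_nat_pow_near ht (by norm_num : (1 : ℝ) < 2)
  have hpoint : ∀ a ∈ s, (D a : ℝ)⁻¹ ≤ (2 ^ h)⁻¹ +
      ∑ j ∈ Finset.range h, if D a ≤ 2 ^ (j + 1) then ((2 : ℝ) ^ j)⁻¹ else 0 := by
    intro a ha
    have hnonneg : ∀ j ∈ Finset.range h,
        (0 : ℝ) ≤ if D a ≤ 2 ^ (j + 1) then ((2 : ℝ) ^ j)⁻¹ else 0 := fun j _ => by
      split_ifs <;> positivity
    by_cases hDa : 2 ^ h ≤ D a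
    · refine le_add_of_le_of_nonneg (inv_anti₀ (by positivity) (by exact_mod_cast hDa))
        (Finset.sum_nonneg hnonneg)
    · have h1 : Nat.log 2 (D a) < h := Nat.log_lt_of_lt_pow (by have := hD a ha; omega) (by omega)
      refine le_add_of_nonneg_of_le (by positivity) (le_trans ?_
        (Finset.single_le_sum hnonneg (Finset.mem_range.2 h1)))
      rw [if_pos (Nat.lt_pow_succ_log_self (by norm_num) _).le]
      refine inv_anti₀ (by positivity) ?_
      exact_mod_cast Nat.pow_log_le_self 2 (by have := hD a ha; omega)
  have hlarge : (s.card : ℝ) * (2 ^ h)⁻¹ ≤ 2 * t ^ n := by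
    rw [← div_eq_mul_inv, div_le_iff₀ (by positivity)]
    refine hs.trans ?_
    rw [pow_succ t, pow_succ (2 : ℝ)] at *
    have : 0 < t ^ n := by positivity
    nlinarith
  have hsmall : ∀ j ∈ Finset.range h,
      ∑ a ∈ s, (if D a ≤ 2 ^ (j + 1) then ((2 : ℝ) ^ j)⁻¹ else 0) ≤
        C * 2 ^ (n + 1) * 2 ^ (j * n) := by
    intro j _
    rw [← Finset.sum_filter, Finset.sum_const, nsmul_eq_mul, ← div_eq_mul_inv,
      div_le_iff₀ (by positivity)]
    refine (hcard (j + 1)).trans (le_of_eq ?_)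
    ring
  calc ∑ a ∈ s, (D a : ℝ)⁻¹
      ≤ ∑ a ∈ s, ((2 ^ h)⁻¹ +
          ∑ j ∈ Finset.range h, if D a ≤ 2 ^ (j + 1) then ((2 : ℝ) ^ j)⁻¹ else 0) :=
        Finset.sum_le_sum hpoint
    _ = s.card * (2 ^ h)⁻¹ + ∑ j ∈ Finset.range h,
          ∑ a ∈ s, (if D a ≤ 2 ^ (j + 1) then ((2 : ℝ) ^ j)⁻¹ else 0) := by
        rw [Finset.sum_add_distrib, Finset.sum_const, nsmul_eq_mul, Finset.sum_comm]
    _ ≤ 2 * t ^ n + ∑ j ∈ Finset.range h, C * 2 ^ (n + 1) * 2 ^ (j * n) :=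
        add_le_add hlarge (Finset.sum_le_sum hsmall)
    _ ≤ 2 * t ^ n + C * 2 ^ (n + 1) * t ^ n := by
        rw [← Finset.mul_sum]
        gcongr
        refine (sum_two_pow_mul_le hn h).trans ?_
        rw [pow_mul]
        gcongr
    _ = _ := by ring

lemma card_heightLe_le (n : ℕ) (B : ℝ)
    (𝒱 𝒲 : Finset (Submodule ℚ (Fin (n + 1) → ℚ)))
    (h𝒱 : ∀ V ∈ 𝒱, ∃ W ∈ 𝒲, boxPoints V ⌊B⌋₊ ⊆ boxPoints W ⌊B⌋₊) :
    Nat.card {p : Projectivization ℚ (Fin (n + 1) → ℚ) //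
      HeightLe n B p ∧ ∃ V ∈ 𝒱, p.rep ∈ V} ≤ ∑ W ∈ 𝒲, (boxPoints W ⌊B⌋₊).card := by
  classical
  refine le_trans ?_ (Finset.card_biUnion_le (s := 𝒲) (t := fun W => boxPoints W ⌊B⌋₊))
  have hex : ∀ p : {p : Projectivization ℚ (Fin (n + 1) → ℚ) //
      HeightLe n B p ∧ ∃ V ∈ 𝒱, p.rep ∈ V}, ∃ x : 𝒲.biUnion fun W => boxPoints W ⌊B⌋₊,
      ∃ hx : ratVec (n + 1) x.1 ≠ 0, Projectivization.mk ℚ _ hx = p.1 := by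
    rintro ⟨p, ⟨x, hx, rfl, hxB⟩, V, hV, hp⟩
    obtain ⟨W, hW, hVW⟩ := h𝒱 V hV
    refine ⟨⟨x, Finset.mem_biUnion.2 ⟨W, hW, hVW (mem_boxPoints.2 ⟨?_, ?_⟩)⟩⟩, hx, rfl⟩
    · refine supNatAbs_le.2 fun i => ?_
      have : (x i).natAbs ≤ ⌊B⌋₊ := Nat.le_floor (by
        rw [Nat.cast_natAbs]
        exact_mod_cast hxB i)
      rw [Int.abs_eq_natAbs]
      exact_mod_cast this
    · obtain ⟨u, hu⟩ := Projectivization.exists_smul_eq_mk_rep ℚ _ hx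
      rw [← hu] at hp
      exact (Submodule.smul_mem_iff_of_isUnit V u.isUnit).1 hp
  choose f hf hfp using hex
  rw [← Nat.card_eq_finsetCard]
  refine Nat.card_le_card_of_injective f fun p q hpq => Subtype.ext ?_
  rw [← hfp p, ← hfp q]
  congr 1
  rw [hpq]

/-- Proposition 3.2 (sublinear projective Schwartz-Zippel for unions of linear
varieties): any `d` `k`-planes in `ℙ^n_ℚ` jointly contain at most
`c(n) d^{n/(n+1)} B^{k+1}` rational points of height `≤ B`. -/
theorem stmt_11 (n k : ℕ) (hkn : k < n) :
    ∃ c : ℝ, 0 < c ∧ ∀ (d B : ℝ), 1 ≤ d → 1 ≤ B →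
      ∀ 𝒱 : Finset (Submodule ℚ (Fin (n + 1) → ℚ)),
        (∀ V ∈ 𝒱, Module.finrank ℚ V = k + 1) → (𝒱.card : ℝ) ≤ d →
        (Nat.card {p : Projectivization ℚ (Fin (n + 1) → ℚ) //
            HeightLe n B p ∧ ∃ V ∈ 𝒱, p.rep ∈ V} : ℝ)
          ≤ c * d ^ ((n : ℝ) / (n + 1)) * B ^ (k + 1) := by
  obtain ⟨A, hA⟩ : ∃ A : ℕ, ∀ r ≤ k + 1, ∀ (W : Submodule ℚ (Fin (n + 1) → ℚ)) (D L : ℕ),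
      ReducedFlag r W D L → ∀ R, L ≤ R → D * (boxPoints W R).card ≤ A * R ^ r := by
    choose A hA using ReducedFlag.exists_prod_mul_card_le (n + 1)
    refine ⟨∑ i ∈ Finset.range (k + 2), A i, fun r hr W D L h R hR =>
      (hA r W D L h R hR).trans (Nat.mul_le_mul_right _ ?_)⟩
    exact Finset.single_le_sum (fun _ _ => Nat.zero_le _) (Finset.mem_range.2 (by omega))
  choose C hC using ReducedFlag.exists_card_le n.succ_pos
  set C' : ℕ := ∑ i ∈ Finset.range (k + 2), C i
  refine ⟨(A + 1) * (2 + C' * 2 ^ (n + 1)), by positivity, fun d B hd hB 𝒱 h𝒱 h𝒱d => ?_⟩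
  classical
  set R := ⌊B⌋₊
  have hR : 1 ≤ R := Nat.le_floor (by simpa using hB)
  have hRB : (R : ℝ) ≤ B := Nat.floor_le (by linarith)
  choose r W D L hflag hLR hWV hsub using fun V => ReducedFlag.exists_boxPoints_subset V hR
  set 𝒲 := 𝒱.image W
  have h𝒲 : ∀ U ∈ 𝒲, ∃ r D L, r ≤ k + 1 ∧ ReducedFlag r U D L ∧ L ≤ R := by
    intro U hU
    obtain ⟨V, hV, rfl⟩ := Finset.mem_image.1 hU
    refine ⟨_, _, _, ?_, hflag V, hLR V⟩
    rw [← (hflag V).finrank_eq, ← h𝒱 V hV]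
    exact Submodule.finrank_mono (hWV V)
  choose! ρ Δ Λ hρ hΔ hΛ using h𝒲
  set t : ℝ := d ^ (1 / ((n : ℝ) + 1)) with ht_def
  have hd0 : 0 ≤ d := by linarith
  have ht : 1 ≤ t := Real.one_le_rpow hd (by positivity)
  have htn : t ^ n = d ^ ((n : ℝ) / (n + 1)) := by
    rw [ht_def, ← Real.rpow_natCast, ← Real.rpow_mul hd0]
    congr 1
    ring
  have htn' : t ^ (n + 1) = d := by
    rw [ht_def, ← Real.rpow_natCast, ← Real.rpow_mul hd0]
    push_cast
    rw [one_div_mul_cancel (by positivity), Real.rpow_one]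
  have hcount : ∀ h : ℕ, ((𝒲.filter fun U => Δ U ≤ 2 ^ h).card : ℝ) ≤
      (C' : ℝ) * 2 ^ (h * (n + 1)) := by
    intro h
    have : (𝒲.filter fun U => Δ U ≤ 2 ^ h).card ≤ C' * 2 ^ (h * (n + 1)) := by
      rw [Finset.card_eq_sum_card_fiberwise (f := ρ) (t := Finset.range (k + 2)) (fun U hU => by
        have := hρ U (Finset.mem_filter.1 hU).1
        exact Finset.mem_coe.2 (Finset.mem_range.2 (by omega))), Finset.sum_mul]
      refine Finset.sum_le_sum fun i _ => hC i h _ fun U hU => ?_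
      obtain ⟨hUh, rfl⟩ := Finset.mem_filter.1 hU
      obtain ⟨hU𝒲, hle⟩ := Finset.mem_filter.1 hUh
      exact ⟨_, _, hΔ U hU𝒲, hle⟩
    exact_mod_cast this
  have hsum := sum_inv_le 𝒲 Δ C' (Nat.cast_nonneg _) (by omega : 1 ≤ n)
    (fun U hU => (hΔ U hU).one_le_prod) hcount ht (by
      rw [htn']
      refine le_trans ?_ h𝒱d
      exact_mod_cast Finset.card_image_le)
  have hbox : ∀ U ∈ 𝒲, ((boxPoints U R).card : ℝ) ≤ (A + 1) * B ^ (k + 1) * (Δ U : ℝ)⁻¹ := by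
    intro U hU
    have hpos : (0 : ℝ) < Δ U := by exact_mod_cast (hΔ U hU).one_le_prod
    rw [← div_eq_mul_inv, le_div_iff₀ hpos, mul_comm]
    have h1 : (Δ U : ℝ) * (boxPoints U R).card ≤ A * R ^ ρ U := by
      exact_mod_cast hA _ (hρ U hU) U _ _ (hΔ U hU) R (hΛ U hU)
    have h2 : (R : ℝ) ^ ρ U ≤ B ^ (k + 1) :=
      (pow_le_pow_left₀ (Nat.cast_nonneg _) hRB _).trans (pow_le_pow_right₀ hB (hρ U hU))
    refine h1.trans (mul_le_mul (by linarith) h2 (by positivity) (by positivity))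
  have hcard := card_heightLe_le n B 𝒱 𝒲 fun V hV =>
    ⟨W V, Finset.mem_image_of_mem _ hV, hsub V⟩
  calc _ ≤ ((∑ U ∈ 𝒲, (boxPoints U R).card : ℕ) : ℝ) := by exact_mod_cast hcard
    _ = ∑ U ∈ 𝒲, ((boxPoints U R).card : ℝ) := by push_cast; rfl
    _ ≤ ∑ U ∈ 𝒲, (A + 1) * B ^ (k + 1) * (Δ U : ℝ)⁻¹ := Finset.sum_le_sum hbox
    _ ≤ (A + 1) * B ^ (k + 1) * ((2 + C' * 2 ^ (n + 1)) * t ^ n) := by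
      rw [← Finset.mul_sum]
      gcongr
    _ = _ := by rw [htn]; ring
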